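/- Let 0 < β < 1, γ > 0, π ≥ 0, δ* > 0, z₀ > 0, and set z̄ := ((δ*+π)/(βγ))^{1/(1−β)} and a := (1−β)(δ*+π)/β. Define z(t) := z̄·z₀ / [ (z̄^{1−β} − z₀^{1−β})·e^{−a t} + z₀^{1−β} ]^{1/(1−β)} for t ≥ 0. Then z(0) = z₀, z(t) > 0 for all t ≥ 0, and for all t ≥ 0, z'(t) = ((δ*+π)/β)·z(t)·(1 − (z(t)/z̄)^{1−β}); equivalently z'(t)/z(t) = (δ*+π)/β − γ·z(t)^{1−β}. -/

import Mathlib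

open Real

/-- The denominator of the closed form stays positive: it is a convex combination of two
positive numbers. -/
lemma bernoulli_denominator_pos {P w a t : ℝ} (hP : 0 < P) (hw : 0 < w) (ha : 0 < a)
    (ht : 0 ≤ t) : 0 < (P - w) * Real.exp (-a * t) + w := by
  have he : Real.exp (-a * t) ≤ 1 := Real.exp_le_one_iff.2 (by nlinarith)
  nlinarith [mul_pos hP (Real.exp_pos (-a * t)), mul_nonneg hw.le (sub_nonneg.2 he)]

/-- The derivative of `c / D ^ s`, where `D t = (P - w) * exp (-a * t) + w` solves
`D' = a * (w - D)`. -/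
lemma hasDerivAt_bernoulli {P w a t : ℝ} (c s : ℝ)
    (hD : 0 < (P - w) * Real.exp (-a * t) + w) :
    HasDerivAt (fun t => c / ((P - w) * Real.exp (-a * t) + w) ^ s)
      (s * a * (c / ((P - w) * Real.exp (-a * t) + w) ^ s) *
        (1 - w / ((P - w) * Real.exp (-a * t) + w))) t := by
  have hlin : HasDerivAt (fun t : ℝ => -a * t) (-a) t := by
    simpa using (hasDerivAt_id t).const_mul (-a)
  have hden := (hlin.exp.const_mul (P - w)).add_const w
  have hpow := hden.rpow_const (p := s) (Or.inl hD.ne')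
  refine ((hasDerivAt_const t c).fun_div hpow (rpow_pos_of_pos hD s).ne').congr_deriv ?_
  rw [rpow_sub_one hD.ne']
  have hDs := (rpow_pos_of_pos hD s).ne'
  have hD' := hD.ne'
  generalize ((P - w) * Real.exp (-a * t) + w) ^ s = X at hDs ⊢
  generalize Real.exp (-a * t) = e at hD' ⊢
  field_simp
  ring

/-- The explicit closed-form transitional-dynamics variable z of the transformed
Lucas-Uzawa model: initial condition, positivity, and the ODE
z' = ((δ*+π)/β)·z·(1 - (z/z̄)^{1-β}), equivalently z'/z = (δ*+π)/β - γz^{1-β}. -/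
theorem z_closed_form (β γ pi δs z0 : ℝ)
    (hβ0 : 0 < β) (hβ1 : β < 1) (hγ : 0 < γ) (hpi : 0 ≤ pi) (hδs : 0 < δs)
    (hz0 : 0 < z0)
    (zbar a : ℝ)
    (hzbar : zbar = ((δs + pi) / (β * γ)) ^ (1 / (1 - β)))
    (ha : a = (1 - β) * (δs + pi) / β)
    (z : ℝ → ℝ)
    (hz : ∀ t, z t = zbar * z0 /
      ((zbar ^ (1 - β) - z0 ^ (1 - β)) * Real.exp (-a * t) + z0 ^ (1 - β))
        ^ (1 / (1 - β))) :
    z 0 = z0 ∧ (∀ t ≥ (0:ℝ), 0 < z t) ∧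
    (∀ t ≥ (0:ℝ), HasDerivAt z ((δs + pi) / β * z t * (1 - (z t / zbar) ^ (1 - β))) t) ∧
    (∀ t ≥ (0:ℝ), deriv z t / z t = (δs + pi) / β - γ * z t ^ (1 - β)) := by
  have hs : 0 < 1 - β := by linarith
  have hK : 0 < δs + pi := by linarith
  have hq : 0 < (δs + pi) / (β * γ) := by positivity
  have hzb : 0 < zbar := hzbar ▸ rpow_pos_of_pos hq _
  have hzb_pow : zbar ^ (1 - β) = (δs + pi) / (β * γ) := by
    rw [hzbar, one_div, rpow_inv_rpow hq.le hs.ne']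
  have ha0 : 0 < a := by rw [ha]; positivity
  have hD : ∀ t ≥ (0 : ℝ), 0 < (zbar ^ (1 - β) - z0 ^ (1 - β)) * Real.exp (-a * t)
      + z0 ^ (1 - β) := fun t ht =>
    bernoulli_denominator_pos (rpow_pos_of_pos hzb _) (rpow_pos_of_pos hz0 _) ha0 ht
  have hpos : ∀ t ≥ (0 : ℝ), 0 < z t := fun t ht => by
    rw [hz]
    exact div_pos (mul_pos hzb hz0) (rpow_pos_of_pos (hD t ht) _)
  have hratio : ∀ t ≥ (0 : ℝ), (z t / zbar) ^ (1 - β) = z0 ^ (1 - β) /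
      ((zbar ^ (1 - β) - z0 ^ (1 - β)) * Real.exp (-a * t) + z0 ^ (1 - β)) := fun t ht => by
    rw [hz, div_right_comm, mul_div_cancel_left₀ _ hzb.ne',
      div_rpow hz0.le (rpow_nonneg (hD t ht).le _), one_div,
      rpow_inv_rpow (hD t ht).le hs.ne']
  have hderiv : ∀ t ≥ (0 : ℝ),
      HasDerivAt z ((δs + pi) / β * z t * (1 - (z t / zbar) ^ (1 - β))) t := fun t ht => by
    have hrate : 1 / (1 - β) * a = (δs + pi) / β := by
      rw [ha]
      field_simp
    rw [hratio t ht, ← hrate, hz t, funext hz]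
    exact hasDerivAt_bernoulli _ _ (hD t ht)
  refine ⟨?_, hpos, hderiv, fun t ht => ?_⟩
  · rw [hz, mul_zero, Real.exp_zero, mul_one, sub_add_cancel, one_div,
      rpow_rpow_inv hzb.le hs.ne', mul_div_cancel_left₀ _ hzb.ne']
  · rw [(hderiv t ht).deriv, div_rpow (hpos t ht).le hzb.le, hzb_pow]
    have := (hpos t ht).ne'
    field_simp
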